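/- Let ω > 0, α ∈ ℝ, and let ρ_{r0}, ρ_{r1}, ρ_i be real numbers with 0 < ρ_{r0} ≤ ρ_{r1} and ρ_i > 0. Then for all real numbers s ≥ 0, t ≥ 0, and all real r satisfying (1 + ρ_{r0})·s ≤ r ≤ (1 + ρ_{r1})·s, one has |1 + t + α²·s − r| + ω²·ρ_i·s ≥ 2·min{ ω²·ρ_i / (4·(1 + ρ_{r1})), 1/4 }. -/

import Mathlib

/-- The scalar inequality underlying the coercivity bound
`|a(u,u)| ≥ c = min{ω²ρᵢ/(4(1+ρ_{r1})), 1/4}` in the existence proof. -/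
theorem stmt_0 (ω α ρr0 ρr1 ρi : ℝ) (hω : 0 < ω)
    (hρr0 : 0 < ρr0) (hρr : ρr0 ≤ ρr1) (hρi : 0 < ρi) :
    ∀ s t r : ℝ, 0 ≤ s → 0 ≤ t →
      (1 + ρr0) * s ≤ r → r ≤ (1 + ρr1) * s →
      2 * min (ω ^ 2 * ρi / (4 * (1 + ρr1))) (1 / 4) ≤
        |1 + t + α ^ 2 * s - r| + ω ^ 2 * ρi * s := by
  intro s t r hs ht h0 h1
  have hK : 0 < 1 + ρr1 := by linarith
  have hW : 0 < ω ^ 2 * ρi := by positivity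
  have hWs : 0 ≤ ω ^ 2 * ρi * s := by positivity
  have hαs : 0 ≤ α ^ 2 * s := by positivity
  by_cases h : (1 + ρr1) * s ≤ 1 / 2
  · have h2 := min_le_right (ω ^ 2 * ρi / (4 * (1 + ρr1))) (1 / 4 : ℝ)
    have h3 := le_abs_self (1 + t + α ^ 2 * s - r)
    linarith
  · have h2 := min_le_left (ω ^ 2 * ρi / (4 * (1 + ρr1))) (1 / 4 : ℝ)
    have h3 := abs_nonneg (1 + t + α ^ 2 * s - r)
    have h4 : ω ^ 2 * ρi / (4 * (1 + ρr1)) ≤ ω ^ 2 * ρi * s / 2 := by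
      rw [div_le_iff₀ (by positivity)]
      have := mul_le_mul_of_nonneg_left (not_le.mp h).le hW.le
      linarith
    linarith
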